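/- arXiv:1501.05873 — 2 statements merged into one kernel-verified Lean document; each statement's English description precedes it below -/
import Mathlib

section
/- Let α > 0 and set Ψ(t) = (1 − |t|^α)₊. For all symmetric probability measures ν₁, ν₂ on ℝ and all t ∈ ℝ, ∫_ℝ Ψ(xt) (ν₁ ▵_α ν₂)(dx) = ν̂₁(t) · ν̂₂(t), i.e. the Williamson transform of the Kendall convolution of two symmetric probability measures is the product of their Williamson transforms. -/
open MeasureTheory

/-- `Ψ(t) = (1 - |t|^α)₊`. -/
noncomputable def Psi (α t : ℝ) : ℝ := max (1 - |t| ^ α) 0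

/-- The Williamson transform of a measure on `ℝ`. -/
noncomputable def williamson (α : ℝ) (ν : Measure ℝ) (t : ℝ) : ℝ :=
  ∫ x, Psi α (x * t) ∂ν

/-- A measure on `ℝ` is symmetric if it is invariant under `x ↦ -x`. -/
def IsSymmetric (ν : Measure ℝ) : Prop := ν.map (fun x => -x) = ν

/-- The rescaling operator `T_a`: `(T_a λ)(A) = λ(A / a)` for `a ≠ 0`, `T_0 λ = δ_0`. -/
noncomputable def rescale (a : ℝ) (μ : Measure ℝ) : Measure ℝ :=
  if a = 0 then Measure.dirac 0 else μ.map (fun x => a * x)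

/-- `δ̃_x = (δ_x + δ_{-x})/2`. -/
noncomputable def deltaTilde (x : ℝ) : Measure ℝ :=
  (2 : ENNReal)⁻¹ • (Measure.dirac x + Measure.dirac (-x))

/-- The symmetric Pareto measure `π̃_{2α}` with density `α |y|^{-2α-1} 1_{|y| ≥ 1}`. -/
noncomputable def pareto (α : ℝ) : Measure ℝ :=
  volume.withDensity fun y =>
    ENNReal.ofReal (if 1 ≤ |y| then α * |y| ^ (-2 * α - 1) else 0)

/-- Kendall convolution of two symmetric two-point masses:
`δ̃_x ▵_α δ̃_y = T_M (ϱ^α π̃_{2α} + (1 - ϱ^α) δ̃_1)`. -/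
noncomputable def kendallPoint (α x y : ℝ) : Measure ℝ :=
  let M := max |x| |y|
  let m := min |x| |y|
  let ρ := if M = 0 then 0 else m / M
  rescale M (ENNReal.ofReal (ρ ^ α) • pareto α +
    ENNReal.ofReal (1 - ρ ^ α) • deltaTilde 1)

/-- Kendall convolution of two measures on `ℝ`:
`(ν₁ ▵_α ν₂)(A) = ∫∫ (δ̃_x ▵_α δ̃_y)(A) ν₁(dx) ν₂(dy)`. -/
noncomputable def kendall (α : ℝ) (ν₁ ν₂ : Measure ℝ) : Measure ℝ :=
  ν₁.bind fun x => ν₂.bind fun y => kendallPoint α x y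

/-- `n`-fold Kendall convolution power `ν^{▵_α n}`. -/
noncomputable def kendallPow (α : ℝ) (ν : Measure ℝ) : ℕ → Measure ℝ
  | 0 => Measure.dirac 0
  | 1 => ν
  | n + 2 => kendall α (kendallPow α ν (n + 1)) ν

/-- The one-step kernel of the Kendall random walk: `K(x, ·) = δ̃_x ▵_α ν`. -/
noncomputable def kendallKernel (α : ℝ) (ν : Measure ℝ) (x : ℝ) : Measure ℝ :=
  ν.bind fun y => kendallPoint α x y

/-- `excursion α ν n` is the sub-probability distribution of `X_{n+1}` on the event
`X₁ ≤ 0, …, X_n ≤ 0` for the Kendall random walk started at `0`, so that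
`Φ_{n+1}(t) = excursion α ν n ((0,t))`. -/
noncomputable def excursion (α : ℝ) (ν : Measure ℝ) : ℕ → Measure ℝ
  | 0 => ν
  | n + 1 => ((excursion α ν n).restrict (Set.Iic 0)).bind (kendallKernel α ν)

lemma Psi_nonneg (α t : ℝ) : 0 ≤ Psi α t := le_max_right _ _

lemma Psi_abs (α t : ℝ) : Psi α |t| = Psi α t := by simp [Psi]

lemma Psi_measurable (α t : ℝ) : Measurable (fun x => ENNReal.ofReal (Psi α (x * t))) := by
  unfold Psi
  fun_prop

lemma lintegral_even (f : ℝ → ENNReal) (hf : ∀ x, f (-x) = f x) :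
    ∫⁻ x, f x = 2 * ∫⁻ x in Set.Ioi 0, f x := by
  rw [← lintegral_add_compl f (measurableSet_Ioi (a := (0 : ℝ))), two_mul]
  congr 1
  rw [Set.compl_Ioi, setLIntegral_congr (Iio_ae_eq_Iic (a := (0 : ℝ))).symm]
  have h := (Measure.measurePreserving_neg (volume : Measure ℝ)).setLIntegral_comp_preimage_emb
    (MeasurableEquiv.neg ℝ).measurableEmbedding f (Set.Ioi 0)
  simp only [hf] at h
  rw [← h]
  congr 2
  ext x
  simp

lemma hasDerivAt_max_sq (u : ℝ) : HasDerivAt (fun v : ℝ => (max v 0) ^ 2) (2 * max u 0) u := by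
  rcases lt_trichotomy u 0 with h | h | h
  · rw [max_eq_right h.le, mul_zero]
    refine (hasDerivAt_const u (0 : ℝ)).congr_of_eventuallyEq ?_
    filter_upwards [Iio_mem_nhds h] with v hv
    rw [max_eq_right (le_of_lt hv)]
    simp
  · subst h
    rw [max_self, mul_zero, hasDerivAt_iff_isLittleO]
    simp only [max_self, sub_zero, smul_zero]
    have h1 : (fun x : ℝ => x ^ 2) =o[nhds 0] (fun x : ℝ => x) := by
      simpa using Asymptotics.isLittleO_pow_pow (𝕜 := ℝ) (m := 1) (n := 2) (by norm_num)
    refine Asymptotics.IsBigO.trans_isLittleO (Asymptotics.IsBigO.of_bound 1 ?_) h1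
    filter_upwards with x
    rcases le_total x 0 with hx | hx
    · simp [max_eq_right hx]; positivity
    · simp [max_eq_left hx]
  · rw [max_eq_left h.le]
    have h2 : HasDerivAt (fun v : ℝ => v ^ 2) (2 * u) u := by
      simpa using hasDerivAt_pow 2 u
    refine h2.congr_of_eventuallyEq ?_
    filter_upwards [Ioi_mem_nhds h] with v hv
    rw [max_eq_left (le_of_lt hv)]

lemma pareto_aux (α : ℝ) (hα : 0 < α) (C : ℝ) (hC : 0 ≤ C) :
    ∫⁻ z in Set.Ioi (1 : ℝ), ENNReal.ofReal (2 * α * z ^ (-2 * α - 1) * max (1 - z ^ α * C) 0)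
      = ENNReal.ofReal ((max (1 - C) 0) ^ 2) := by
  have hd : ∀ z ∈ Set.Ici (1 : ℝ), HasDerivAt (fun z : ℝ => -(max (z ^ (-α) - C) 0) ^ 2)
      (2 * α * z ^ (-2 * α - 1) * max (1 - z ^ α * C) 0) z := by
    intro z hz
    have hz0 : 0 < z := lt_of_lt_of_le one_pos hz
    have h1 : HasDerivAt (fun z : ℝ => z ^ (-α) - C) (-α * z ^ (-α - 1)) z :=
      (Real.hasDerivAt_rpow_const (Or.inl hz0.ne')).sub_const C
    have h2 := ((hasDerivAt_max_sq (z ^ (-α) - C)).comp z h1).neg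
    refine h2.congr_deriv ?_
    have e1 : z ^ (-α) - C = z ^ (-α) * (1 - z ^ α * C) := by
      rw [mul_sub, ← mul_assoc, ← Real.rpow_add hz0]; simp
    have e2 : max (z ^ (-α) - C) 0 = z ^ (-α) * max (1 - z ^ α * C) 0 := by
      rw [mul_max_of_nonneg _ _ (Real.rpow_nonneg hz0.le _), mul_zero, e1]
    have e3 : z ^ (-2 * α - 1) = z ^ (-α) * z ^ (-α - 1) := by
      rw [← Real.rpow_add hz0]; ring_nf
    rw [e2, e3]; ring
  have hpos : ∀ z ∈ Set.Ioi (1 : ℝ), 0 ≤ 2 * α * z ^ (-2 * α - 1) * max (1 - z ^ α * C) 0 := by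
    intro z hz
    have hz0 : 0 < z := lt_trans one_pos hz
    have := Real.rpow_nonneg hz0.le (-2 * α - 1)
    have := le_max_right (1 - z ^ α * C) 0
    positivity
  have hlim : Filter.Tendsto (fun z : ℝ => -(max (z ^ (-α) - C) 0) ^ 2) Filter.atTop (nhds 0) := by
    have h := (((tendsto_rpow_neg_atTop hα).sub_const C).max (tendsto_const_nhds (x := (0 : ℝ)))).pow 2 |>.neg
    simpa [hC] using h
  rw [← ofReal_integral_eq_lintegral_ofReal (integrableOn_Ioi_deriv_of_nonneg' hd hpos hlim)
    ((ae_restrict_iff' measurableSet_Ioi).2 (Filter.Eventually.of_forall hpos)),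
    integral_Ioi_of_hasDerivAt_of_nonneg' hd hpos hlim]
  simp

lemma pareto_lintegral (α : ℝ) (hα : 0 < α) (s : ℝ) :
    ∫⁻ z, ENNReal.ofReal (Psi α (z * s)) ∂(pareto α) = ENNReal.ofReal (Psi α s ^ 2) := by
  have hm : Measurable (fun y : ℝ =>
      ENNReal.ofReal (if 1 ≤ |y| then α * |y| ^ (-2 * α - 1) else 0)) := by
    refine (Measurable.ite (measurableSet_le (by fun_prop) (by fun_prop)) ?_ ?_).ennreal_ofReal
      <;> fun_prop
  unfold pareto
  rw [lintegral_withDensity_eq_lintegral_mul _ hm (Psi_measurable α s), lintegral_even]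
  swap
  · intro x; simp [Psi]
  have h2 := pareto_aux α hα (|s| ^ α) (by positivity)
  have hq := Psi_measurable α s
  unfold Psi at hq ⊢
  rw [← h2, ← lintegral_const_mul _ (hm.mul hq),
    ← Set.Ioc_union_Ioi_eq_Ioi (zero_le_one (α := ℝ)),
    lintegral_union measurableSet_Ioi
      (Set.disjoint_left.2 fun x hx hx' => not_lt.2 hx.2 hx')]
  have hz : ∫⁻ (a : ℝ) in Set.Ioc 0 1, 2 * ((fun y : ℝ =>
      ENNReal.ofReal (if 1 ≤ |y| then α * |y| ^ (-2 * α - 1) else 0)) *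
      fun z => ENNReal.ofReal (max (1 - |z * s| ^ α) 0)) a = 0 := by
    rw [setLIntegral_congr (Ioo_ae_eq_Ioc (a := (0 : ℝ)) (b := 1)).symm]
    rw [setLIntegral_congr_fun (g := fun _ => 0) measurableSet_Ioo]
    · simp
    · intro x hx
      have : ¬ (1 ≤ |x|) := by rw [abs_of_pos hx.1]; exact not_le.2 hx.2
      simp [this]
  rw [hz, zero_add]
  refine setLIntegral_congr_fun measurableSet_Ioi fun x hx => ?_
  have hx0 : 0 < x := lt_trans one_pos hx
  have hx1 : 1 ≤ |x| := by rw [abs_of_pos hx0]; exact le_of_lt hx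
  simp only [Pi.mul_apply, if_pos hx1]
  rw [abs_mul, abs_of_pos hx0, Real.mul_rpow hx0.le (abs_nonneg s),
    ← ENNReal.ofReal_mul (by positivity), ← ENNReal.ofReal_ofNat 2,
    ← ENNReal.ofReal_mul (by norm_num)]
  ring_nf

lemma delta_lintegral (α s : ℝ) :
    ∫⁻ z, ENNReal.ofReal (Psi α (z * s)) ∂(deltaTilde 1) = ENNReal.ofReal (Psi α s) := by
  have h : Psi α (-s) = Psi α s := by simp [Psi]
  simp only [deltaTilde, lintegral_smul_measure, lintegral_add_measure, lintegral_dirac, one_mul,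
    neg_mul, h, ← two_mul, smul_eq_mul]
  rw [← mul_assoc, ENNReal.inv_mul_cancel (by norm_num) (by norm_num), one_mul]

lemma point_alg (α t M m : ℝ) (hα : 0 < α) (hM : 0 < M) (hm : 0 ≤ m) (hmM : m ≤ M) :
    ENNReal.ofReal ((m / M) ^ α) * ENNReal.ofReal (Psi α (M * t) ^ 2) +
      ENNReal.ofReal (1 - (m / M) ^ α) * ENNReal.ofReal (Psi α (M * t))
      = ENNReal.ofReal (Psi α (M * t) * Psi α (m * t)) := by
  have hr0 : 0 ≤ (m / M) ^ α := by positivity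
  have hr1 : (m / M) ^ α ≤ 1 := Real.rpow_le_one (by positivity) ((div_le_one hM).2 hmM) hα.le
  have hp := Psi_nonneg α (M * t)
  have hmt : |m * t| ^ α = (m / M) ^ α * |M * t| ^ α := by
    rw [← Real.mul_rpow (by positivity) (by positivity), abs_mul, abs_mul, abs_of_pos hM,
      abs_of_nonneg hm]
    congr 1
    field_simp
  rw [← ENNReal.ofReal_mul hr0, ← ENNReal.ofReal_mul (by linarith),
    ← ENNReal.ofReal_add (by positivity) (mul_nonneg (by linarith) hp)]
  congr 1
  unfold Psi
  rw [hmt]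
  have hC : 0 ≤ |M * t| ^ α := by positivity
  generalize |M * t| ^ α = C at *
  generalize (m / M) ^ α = r at *
  rcases le_total C 1 with h | h
  · rw [max_eq_left (by linarith), max_eq_left (by nlinarith)]; ring
  · rw [max_eq_right (by linarith)]; ring

lemma point_lintegral (α : ℝ) (hα : 0 < α) (t x y : ℝ) :
    ∫⁻ z, ENNReal.ofReal (Psi α (z * t)) ∂(kendallPoint α x y) =
      ENNReal.ofReal (Psi α (x * t)) * ENNReal.ofReal (Psi α (y * t)) := by
  have hab : ∀ u, Psi α (|u| * t) = Psi α (u * t) := by intro u; simp [Psi, abs_mul]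
  have hprod : Psi α (max |x| |y| * t) * Psi α (min |x| |y| * t) =
      Psi α (x * t) * Psi α (y * t) := by
    rcases le_total |x| |y| with h | h
    · rw [max_eq_right h, min_eq_left h, hab, hab, mul_comm]
    · rw [max_eq_left h, min_eq_right h, hab, hab]
  rw [← ENNReal.ofReal_mul (Psi_nonneg _ _), ← hprod]
  have hM0 : 0 ≤ max |x| |y| := le_trans (abs_nonneg x) (le_max_left _ _)
  have hm0 : 0 ≤ min |x| |y| := le_min (abs_nonneg x) (abs_nonneg y)
  have hmM : min |x| |y| ≤ max |x| |y| := min_le_max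
  simp only [kendallPoint]
  generalize max |x| |y| = M at *
  generalize min |x| |y| = m at *
  rcases hM0.eq_or_lt with h | h
  · subst h
    have : m = 0 := le_antisymm hmM hm0
    subst this
    simp [rescale, Psi, Real.zero_rpow hα.ne']
  · rw [rescale, if_neg h.ne', if_neg h.ne',
      lintegral_map (Psi_measurable α t) (by fun_prop)]
    have e : ∀ z, M * z * t = z * (M * t) := fun z => by ring
    simp only [e, lintegral_add_measure, lintegral_smul_measure, smul_eq_mul]
    rw [pareto_lintegral α hα, delta_lintegral, point_alg α t M m hα h hm0 hmM]

instance pareto_sfinite (α : ℝ) : SFinite (pareto α) := by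
  unfold pareto; infer_instance

instance deltaTilde_sfinite (x : ℝ) : SFinite (deltaTilde x) := by
  unfold deltaTilde; infer_instance

lemma kendallPoint_measurable (α : ℝ) :
    Measurable (fun p : ℝ × ℝ => kendallPoint α p.1 p.2) := by
  refine Measure.measurable_of_measurable_coe _ fun s hs => ?_
  have hM : Measurable (fun p : ℝ × ℝ => max |p.1| |p.2|) := by fun_prop
  have hS : MeasurableSet {p : ℝ × ℝ | max |p.1| |p.2| = 0} := hM (measurableSet_singleton 0)
  have hρ : Measurable (fun p : ℝ × ℝ =>
      if max |p.1| |p.2| = 0 then (0 : ℝ) else min |p.1| |p.2| / max |p.1| |p.2|) :=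
    Measurable.ite hS (by fun_prop) (by fun_prop)
  have key : ∀ (μ : Measure ℝ) [SFinite μ],
      Measurable (fun p : ℝ × ℝ => μ ((fun z => max |p.1| |p.2| * z) ⁻¹' s)) := by
    intro μ _
    have h1 : MeasurableSet ((fun q : ℝ × ℝ => q.1 * q.2) ⁻¹' s) :=
      (by fun_prop : Measurable (fun q : ℝ × ℝ => q.1 * q.2)) hs
    exact (measurable_measure_prodMk_left (ν := μ) h1).comp hM
  have e : ∀ p : ℝ × ℝ, kendallPoint α p.1 p.2 s =
      if max |p.1| |p.2| = 0 then Measure.dirac 0 s else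
        ENNReal.ofReal ((if max |p.1| |p.2| = 0 then (0 : ℝ)
            else min |p.1| |p.2| / max |p.1| |p.2|) ^ α) *
          pareto α ((fun z => max |p.1| |p.2| * z) ⁻¹' s) +
        ENNReal.ofReal (1 - (if max |p.1| |p.2| = 0 then (0 : ℝ)
            else min |p.1| |p.2| / max |p.1| |p.2|) ^ α) *
          deltaTilde 1 ((fun z => max |p.1| |p.2| * z) ⁻¹' s) := by
    intro p
    simp only [kendallPoint, rescale]
    by_cases h : max |p.1| |p.2| = 0
    · rw [if_pos h, if_pos h]
    · rw [if_neg h, if_neg h, Measure.map_apply (by fun_prop) hs]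
      simp only [if_neg h, Measure.add_apply, Measure.smul_apply, smul_eq_mul]
  simp only [e]
  refine Measurable.ite hS measurable_const ?_
  refine Measurable.add (Measurable.mul ?_ (key _)) (Measurable.mul ?_ (key _))
  · exact (hρ.pow_const α).ennreal_ofReal
  · exact ((hρ.pow_const α).const_sub 1).ennreal_ofReal

lemma inner_measurable (α : ℝ) (ν : Measure ℝ) [SFinite ν] :
    Measurable (fun x => ν.bind fun y => kendallPoint α x y) := by
  refine Measure.measurable_of_measurable_coe _ fun s hs => ?_
  have hk := kendallPoint_measurable α
  have e : ∀ x, (ν.bind fun y => kendallPoint α x y) s = ∫⁻ y, kendallPoint α x y s ∂ν :=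
    fun x => Measure.bind_apply hs (hk.comp measurable_prodMk_left).aemeasurable
  simp only [e]
  exact Measurable.lintegral_prod_right' ((Measure.measurable_coe hs).comp hk)

/-- The Williamson transform of the Kendall convolution of two symmetric probability
measures is the product of their Williamson transforms. -/
theorem williamson_kendall_mul (α : ℝ) (hα : 0 < α)
    (ν₁ ν₂ : Measure ℝ) [IsProbabilityMeasure ν₁] [IsProbabilityMeasure ν₂]
    (h₁ : IsSymmetric ν₁) (h₂ : IsSymmetric ν₂) (t : ℝ) :
    ∫ x, Psi α (x * t) ∂(kendall α ν₁ ν₂) = williamson α ν₁ t * williamson α ν₂ t := by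
  unfold williamson
  have hn : ∀ μ : Measure ℝ, ∫ x, Psi α (x * t) ∂μ =
      (∫⁻ x, ENNReal.ofReal (Psi α (x * t)) ∂μ).toReal := fun μ =>
    integral_eq_lintegral_of_nonneg_ae (Filter.Eventually.of_forall fun x => Psi_nonneg _ _)
      (by unfold Psi; exact Measurable.aestronglyMeasurable (by fun_prop))
  rw [hn, hn, hn, ← ENNReal.toReal_mul]
  congr 1
  have hp := Psi_measurable α t
  unfold kendall
  rw [Measure.lintegral_bind (inner_measurable α ν₂).aemeasurable hp.aemeasurable]
  have e : ∀ x, ∫⁻ z, ENNReal.ofReal (Psi α (z * t)) ∂(ν₂.bind fun y => kendallPoint α x y) =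
      ENNReal.ofReal (Psi α (x * t)) * ∫⁻ y, ENNReal.ofReal (Psi α (y * t)) ∂ν₂ := by
    intro x
    have hx : Measurable (fun y => kendallPoint α x y) :=
      (kendallPoint_measurable α).comp measurable_prodMk_left
    rw [Measure.lintegral_bind hx.aemeasurable hp.aemeasurable]
    simp only [point_lintegral α hα]
    rw [lintegral_const_mul _ hp]
  simp only [e]
  rw [lintegral_mul_const _ hp]
end

section
/- Let α > 0. The Kendall convolution is jointly continuous with respect to weak convergence: if (λ_n) and (ν_n) are sequences of symmetric probability measures on ℝ converging weakly to symmetric probability measures λ and ν respectively, then λ_n ▵_α ν_n converges weakly to λ ▵_α ν. -/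
open MeasureTheory

theorem kw_pareto_univ (α : ℝ) (hα : 0 < α) : pareto α Set.univ = 1 := by
  have hint : ∫ y : ℝ, (if 1 ≤ |y| then α * |y| ^ (-2 * α - 1) else 0) = 1 := by
    rw [integral_comp_abs (f := fun y : ℝ => if 1 ≤ y then α * y ^ (-2 * α - 1) else 0)]
    have h1 : ∫ y in Set.Ioi (0 : ℝ), (if 1 ≤ y then α * y ^ (-2 * α - 1) else 0)
        = ∫ y in Set.Ioi (1 : ℝ), α * y ^ (-2 * α - 1) := by
      rw [← integral_Ici_eq_integral_Ioi (x := (1 : ℝ)), ← integral_indicator measurableSet_Ioi,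
        ← integral_indicator measurableSet_Ici]
      congr 1
      ext y
      simp only [Set.indicator, Set.mem_Ioi, Set.mem_Ici]
      split_ifs <;> first | rfl | (exfalso; linarith)
    rw [h1, integral_const_mul, integral_Ioi_rpow_of_lt (by linarith) one_pos]
    rw [Real.one_rpow]
    have : (-2 * α - 1 + 1) ≠ 0 := by
      have : -2 * α - 1 + 1 = -2 * α := by ring
      rw [this]; nlinarith
    field_simp
    ring
  have hI : Integrable (fun y : ℝ => if 1 ≤ |y| then α * |y| ^ (-2 * α - 1) else 0) := by
    by_contra h
    rw [integral_undef h] at hint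
    exact zero_ne_one hint
  rw [pareto, withDensity_apply _ MeasurableSet.univ, Measure.restrict_univ,
    ← ofReal_integral_eq_lintegral_ofReal hI, hint, ENNReal.ofReal_one]
  refine Filter.Eventually.of_forall fun y => ?_
  dsimp only [Pi.zero_apply]
  split_ifs
  · positivity
  · exact le_rfl

theorem kw_pareto_prob (α : ℝ) (hα : 0 < α) : IsProbabilityMeasure (pareto α) :=
  ⟨kw_pareto_univ α hα⟩

theorem kw_delta_prob (x : ℝ) : IsProbabilityMeasure (deltaTilde x) := by
  constructor
  simp only [deltaTilde, Measure.smul_apply, Measure.add_apply, measure_univ, smul_eq_mul]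
  rw [one_add_one_eq_two]
  exact ENNReal.inv_mul_cancel two_ne_zero ENNReal.ofNat_ne_top

/-- The ratio of the smaller to the larger absolute value, to the power `α`. -/
noncomputable def kwR (α : ℝ) (p : ℝ × ℝ) : ℝ :=
  (min |p.1| |p.2| / max |p.1| |p.2|) ^ α

theorem kwR_nonneg (α : ℝ) (p : ℝ × ℝ) : 0 ≤ kwR α p := by
  unfold kwR; positivity

theorem kwR_le_one (α : ℝ) (hα : 0 < α) (p : ℝ × ℝ) : kwR α p ≤ 1 := by
  unfold kwR
  refine Real.rpow_le_one (by positivity) ?_ hα.le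
  exact div_le_one_of_le₀ (min_le_max) (by positivity)

theorem kwR_measurable (α : ℝ) : Measurable (kwR α) := by
  unfold kwR
  fun_prop

theorem kw_point_eq (α : ℝ) (hα : 0 < α) (p : ℝ × ℝ) :
    kendallPoint α p.1 p.2 =
      ENNReal.ofReal (kwR α p) • (pareto α).map (fun z => max |p.1| |p.2| * z) +
      ENNReal.ofReal (1 - kwR α p) • (deltaTilde 1).map (fun z => max |p.1| |p.2| * z) := by
  have := kw_delta_prob 1
  unfold kendallPoint rescale
  simp only
  by_cases h : max |p.1| |p.2| = 0
  · have : kwR α p = 0 := by simp [kwR, h, Real.zero_rpow hα.ne']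
    simp [h, this, Measure.map_const]
  · have hm : Measurable fun z : ℝ => max |p.1| |p.2| * z := by fun_prop
    rw [if_neg h, if_neg h, Measure.map_add _ _ hm, Measure.map_smul, Measure.map_smul]
    rfl

theorem kw_map_measurable (μ : Measure ℝ) [SFinite μ] :
    Measurable fun p : ℝ × ℝ => μ.map (fun z => max |p.1| |p.2| * z) := by
  refine Measure.measurable_of_measurable_coe _ fun s hs => ?_
  have h1 : Measurable fun a : ℝ => μ (Prod.mk a ⁻¹' {q : ℝ × ℝ | q.1 * q.2 ∈ s}) :=
    measurable_measure_prodMk_left ((measurable_fst.mul measurable_snd) hs)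
  have h2 : Measurable fun p : ℝ × ℝ => max |p.1| |p.2| := by fun_prop
  convert! h1.comp h2 using 2 with p
  rw [Measure.map_apply (by fun_prop) hs]
  rfl

theorem kw_point_measurable (α : ℝ) (hα : 0 < α) :
    Measurable fun p : ℝ × ℝ => kendallPoint α p.1 p.2 := by
  have := kw_delta_prob 1
  have := kw_pareto_prob α hα
  refine Measure.measurable_of_measurable_coe _ fun s hs => ?_
  simp only [kw_point_eq α hα, Measure.add_apply, Measure.smul_apply, smul_eq_mul]
  have hR := kwR_measurable α
  have h1 := (Measure.measurable_coe hs).comp (kw_map_measurable (pareto α))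
  have h2 := (Measure.measurable_coe hs).comp (kw_map_measurable (deltaTilde 1))
  exact (hR.ennreal_ofReal.mul h1).add ((hR.const_sub 1).ennreal_ofReal.mul h2)

theorem kw_point_prob (α : ℝ) (hα : 0 < α) (p : ℝ × ℝ) :
    IsProbabilityMeasure (kendallPoint α p.1 p.2) := by
  have := kw_delta_prob 1
  have := kw_pareto_prob α hα
  constructor
  rw [kw_point_eq α hα]
  have hm : Measurable fun z : ℝ => max |p.1| |p.2| * z := by fun_prop
  simp only [Measure.add_apply, Measure.smul_apply, smul_eq_mul,
    Measure.map_apply hm MeasurableSet.univ, Set.preimage_univ, measure_univ, mul_one]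
  rw [← ENNReal.ofReal_add (kwR_nonneg α p) (by linarith [kwR_le_one α hα p])]
  simp

/-- The Kendall kernel on pairs. -/
noncomputable def kwK (α : ℝ) (hα : 0 < α) : ProbabilityTheory.Kernel (ℝ × ℝ) ℝ :=
  ⟨fun p => kendallPoint α p.1 p.2, kw_point_measurable α hα⟩

theorem kwK_markov (α : ℝ) (hα : 0 < α) : ProbabilityTheory.IsMarkovKernel (kwK α hα) :=
  ⟨fun p => kw_point_prob α hα p⟩

theorem kw_kendall_eq (α : ℝ) (hα : 0 < α) (μ ν : Measure ℝ) [IsProbabilityMeasure μ]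
    [IsProbabilityMeasure ν] : kendall α μ ν = (μ.prod ν).bind (kwK α hα) := by
  have hm := kw_point_measurable α hα
  have hy : ∀ x, Measurable fun y => kendallPoint α x y := fun x =>
    hm.comp (measurable_prodMk_left (x := x))
  have hx : Measurable fun x => ν.bind fun y => kendallPoint α x y := by
    refine Measure.measurable_of_measurable_coe _ fun s hs => ?_
    simp only [Measure.bind_apply hs (hy _).aemeasurable]
    exact ((Measure.measurable_coe hs).comp hm).lintegral_prod_right'
  ext s hs
  rw [kendall, Measure.bind_apply hs hx.aemeasurable,
    Measure.bind_apply hs (kwK α hα).measurable.aemeasurable]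
  simp only [Measure.bind_apply hs (hy _).aemeasurable]
  exact (lintegral_prod _ ((Measure.measurable_coe hs).comp hm).aemeasurable).symm

theorem kw_integral_kendall (α : ℝ) (hα : 0 < α) (μ ν : Measure ℝ) [IsProbabilityMeasure μ]
    [IsProbabilityMeasure ν] (f : BoundedContinuousFunction ℝ ℝ) :
    ∫ x, f x ∂(kendall α μ ν) = ∫ p, ∫ z, f z ∂(kendallPoint α p.1 p.2) ∂(μ.prod ν) := by
  have := kwK_markov α hα
  rw [kw_kendall_eq α hα]
  have hc := ProbabilityTheory.Kernel.integral_comp (η := kwK α hα)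
    (κ := ProbabilityTheory.Kernel.const Unit (μ.prod ν)) (a := ()) (f := f) (f.integrable _)
  rw [ProbabilityTheory.Kernel.comp_apply, ProbabilityTheory.Kernel.const_apply] at hc
  exact hc

/-- Integral of `f` against the rescaled measure. -/
noncomputable def kwP (μ : Measure ℝ) (f : BoundedContinuousFunction ℝ ℝ) (a : ℝ) : ℝ :=
  ∫ z, f (a * z) ∂μ

theorem kwP_continuous (μ : Measure ℝ) [IsProbabilityMeasure μ]
    (f : BoundedContinuousFunction ℝ ℝ) : Continuous (kwP μ f) := by
  unfold kwP
  refine continuous_of_dominated (bound := fun _ => ‖f‖) ?_ ?_ (integrable_const _) ?_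
  · intro a
    exact (f.continuous.comp (continuous_const.mul continuous_id)).aestronglyMeasurable
  · intro a
    exact Filter.Eventually.of_forall fun z => f.norm_coe_le_norm _
  · exact Filter.Eventually.of_forall fun z =>
      f.continuous.comp (continuous_id.mul continuous_const)

theorem kw_g_eq (α : ℝ) (hα : 0 < α) (f : BoundedContinuousFunction ℝ ℝ) (p : ℝ × ℝ) :
    ∫ z, f z ∂(kendallPoint α p.1 p.2) = kwP (deltaTilde 1) f (max |p.1| |p.2|) +
      kwR α p * (kwP (pareto α) f (max |p.1| |p.2|) - kwP (deltaTilde 1) f (max |p.1| |p.2|)) := by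
  have := kw_delta_prob 1
  have := kw_pareto_prob α hα
  have hm : Measurable fun z : ℝ => max |p.1| |p.2| * z := by fun_prop
  have := Measure.isProbabilityMeasure_map (μ := pareto α) hm.aemeasurable
  have := Measure.isProbabilityMeasure_map (μ := deltaTilde 1) hm.aemeasurable
  rw [kw_point_eq α hα, integral_add_measure
    ((f.integrable _).smul_measure ENNReal.ofReal_ne_top)
    ((f.integrable _).smul_measure ENNReal.ofReal_ne_top), integral_smul_measure,
    integral_smul_measure, integral_map hm.aemeasurable f.continuous.aestronglyMeasurable,
    integral_map hm.aemeasurable f.continuous.aestronglyMeasurable,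
    ENNReal.toReal_ofReal (kwR_nonneg α p),
    ENNReal.toReal_ofReal (by linarith [kwR_le_one α hα p])]
  simp only [kwP, smul_eq_mul]
  ring

theorem kw_g_continuous (α : ℝ) (hα : 0 < α) (f : BoundedContinuousFunction ℝ ℝ) :
    Continuous fun p : ℝ × ℝ => ∫ z, f z ∂(kendallPoint α p.1 p.2) := by
  have := kw_delta_prob 1
  have := kw_pareto_prob α hα
  simp only [kw_g_eq α hα]
  have hM : Continuous fun p : ℝ × ℝ => max |p.1| |p.2| := by fun_prop
  have hD := (kwP_continuous (deltaTilde 1) f).comp hM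
  have hP := (kwP_continuous (pareto α) f).comp hM
  refine hD.add ?_
  rw [continuous_iff_continuousAt]
  intro p
  by_cases h : max |p.1| |p.2| = 0
  · have hd := (hP.sub hD).tendsto p
    have h0 : kwP (pareto α) f (max |p.1| |p.2|) - kwP (deltaTilde 1) f (max |p.1| |p.2|) = 0 := by
      simp [h, kwP]
    simp only [Function.comp_def, Pi.sub_def] at hd
    rw [h0] at hd
    rw [ContinuousAt, h0, mul_zero]
    refine squeeze_zero_norm (fun q => ?_) (by simpa using hd.norm)
    rw [norm_mul, Real.norm_of_nonneg (kwR_nonneg α q)]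
    exact mul_le_of_le_one_left (norm_nonneg _) (kwR_le_one α hα q)
  · refine ContinuousAt.mul ?_ (hP.sub hD).continuousAt
    unfold kwR
    refine ContinuousAt.rpow_const (ContinuousAt.div ?_ hM.continuousAt h) (Or.inr hα.le)
    exact Continuous.continuousAt (by fun_prop)


/-- The Kendall convolution is jointly continuous with respect to weak convergence of
symmetric probability measures (weak convergence stated via integrals of bounded
continuous functions). -/
theorem kendall_weak_continuous (α : ℝ) (hα : 0 < α)
    (lam nu : ℕ → Measure ℝ) (l v : Measure ℝ)
    [∀ n, IsProbabilityMeasure (lam n)] [∀ n, IsProbabilityMeasure (nu n)]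
    [IsProbabilityMeasure l] [IsProbabilityMeasure v]
    (hlam : ∀ n, IsSymmetric (lam n)) (hnu : ∀ n, IsSymmetric (nu n))
    (hl : IsSymmetric l) (hv : IsSymmetric v)
    (hconvl : ∀ f : BoundedContinuousFunction ℝ ℝ,
      Filter.Tendsto (fun n => ∫ x, f x ∂(lam n)) Filter.atTop (nhds (∫ x, f x ∂l)))
    (hconvv : ∀ f : BoundedContinuousFunction ℝ ℝ,
      Filter.Tendsto (fun n => ∫ x, f x ∂(nu n)) Filter.atTop (nhds (∫ x, f x ∂v))) :
    ∀ f : BoundedContinuousFunction ℝ ℝ,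
      Filter.Tendsto (fun n => ∫ x, f x ∂(kendall α (lam n) (nu n))) Filter.atTop
        (nhds (∫ x, f x ∂(kendall α l v))) := by
  intro f
  have hb : ∀ p : ℝ × ℝ, ‖∫ z, f z ∂(kendallPoint α p.1 p.2)‖ ≤ ‖f‖ := fun p => by
    have := kw_point_prob α hα p
    exact f.norm_integral_le_norm _
  let g : BoundedContinuousFunction (ℝ × ℝ) ℝ :=
    BoundedContinuousFunction.ofNormedAddCommGroup _ (kw_g_continuous α hα f) ‖f‖ hb
  simp only [kw_integral_kendall α hα]
  let L : ℕ → ProbabilityMeasure ℝ := fun n => ⟨lam n, inferInstance⟩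
  let N : ℕ → ProbabilityMeasure ℝ := fun n => ⟨nu n, inferInstance⟩
  let L0 : ProbabilityMeasure ℝ := ⟨l, inferInstance⟩
  let N0 : ProbabilityMeasure ℝ := ⟨v, inferInstance⟩
  have hL : Filter.Tendsto L Filter.atTop (nhds L0) :=
    ProbabilityMeasure.tendsto_iff_forall_integral_tendsto.2 hconvl
  have hN : Filter.Tendsto N Filter.atTop (nhds N0) :=
    ProbabilityMeasure.tendsto_iff_forall_integral_tendsto.2 hconvv
  have hprod := (ProbabilityMeasure.continuous_prod.tendsto (L0, N0)).comp (hL.prodMk_nhds hN)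
  exact ProbabilityMeasure.tendsto_iff_forall_integral_tendsto.1 hprod g
end
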